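/- For all polynomials t₁, t₂ ∈ ℚ[X], one has the identity t̂₁ · t̂₂ = (t₁ ∨ t₂)^∧ · 1̂ in the field of rational functions ℚ(y), where (t₁ ∨ t₂)^∧ denotes the hat transform of the polynomial t₁ ∨ t₂, and 1̂ = 1 − 1/(y−1) is the hat transform of the constant polynomial 1. -/

import Mathlib

open Polynomial

/-- The formula for `ℳ(Xⁿ) = ∑_{k=0}^{⌊n/2⌋} (−1)^k · C(n−k, k) · X^{n−k}`. -/
noncomputable def Mform (n : ℕ) : Polynomial ℚ :=
  ∑ k ∈ Finset.range (n / 2 + 1),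
    Polynomial.C ((-1 : ℚ) ^ k * (Nat.choose (n - k) k : ℚ)) * Polynomial.X ^ (n - k)

/-- The formula for `𝒯(Xⁿ) = ∑_{k=1}^{n} (k/(2n−k)) · C(2n−k, n−k) · X^k` (for `n ≥ 1`). -/
noncomputable def Tform (n : ℕ) : Polynomial ℚ :=
  ∑ k ∈ Finset.Icc 1 n,
    Polynomial.C ((k : ℚ) / ((2 * n - k : ℕ) : ℚ) * (Nat.choose (2 * n - k) (n - k) : ℚ)) *
      Polynomial.X ^ k

/-- The generator `y` of the field of rational functions `ℚ(y)`. -/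
noncomputable def yR : RatFunc ℚ := RatFunc.X

/-- The hat transform `t̂ = t(y) − (1/(y−1)) · t(y/(y−1)) ∈ ℚ(y)` of a polynomial `t`. -/
noncomputable def hatY (t : Polynomial ℚ) : RatFunc ℚ :=
  Polynomial.aeval yR t - (1 / (yR - 1)) * Polynomial.aeval (yR / (yR - 1)) t

theorem Mform_eq_sum_antidiagonal (n : ℕ) :
    Mform n = ∑ p ∈ Finset.HasAntidiagonal.antidiagonal n,
      C ((-1 : ℚ) ^ p.2 * (Nat.choose p.1 p.2 : ℚ)) * X ^ p.1 := by
  rw [← Finset.Nat.sum_antidiagonal_swap, Finset.Nat.sum_antidiagonal_eq_sum_range_succ_mk, Mform]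
  refine Finset.sum_subset ?_ ?_
  · intro k hk
    simp only [Finset.mem_range] at hk ⊢
    omega
  · intro k hk hk'
    simp only [Finset.mem_range] at hk hk'
    simp [Nat.choose_eq_zero_of_lt (show n - k < k by omega)]

theorem Mform_add_two (n : ℕ) : Mform (n + 2) = X * Mform (n + 1) - X * Mform n := by
  simp only [Mform_eq_sum_antidiagonal]
  rw [Finset.Nat.antidiagonal_succ_succ', Finset.Nat.antidiagonal_succ']
  simp only [Finset.sum_cons, Finset.sum_map, Function.Embedding.coe_prodMap, mul_add,
    Finset.mul_sum, add_sub_assoc, ← Finset.sum_sub_distrib]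
  simp only [Prod.map, Function.Embedding.coeFn_mk, Function.Embedding.refl_apply,
    Nat.succ_eq_add_one, Nat.choose_zero_succ, Nat.choose_zero_right, Nat.choose_succ_succ']
  have key : ∀ p : ℕ × ℕ,
      (C ((-1 : ℚ) ^ (p.2 + 1) * ((p.1.choose p.2 + p.1.choose (p.2 + 1) : ℕ) : ℚ)) *
        X ^ (p.1 + 1) : ℚ[X]) =
      X * (C ((-1 : ℚ) ^ (p.2 + 1) * (p.1.choose (p.2 + 1) : ℚ)) * X ^ p.1) -
        X * (C ((-1 : ℚ) ^ p.2 * (p.1.choose p.2 : ℚ)) * X ^ p.1) := by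
    intro p
    simp only [map_mul, map_pow, map_neg, map_one, Nat.cast_add, map_add]
    ring
  rw [Finset.sum_congr rfl fun p _ => key p]
  simp
  ring

/-- `ℳ(Xⁿ)` at `y + z = y z` is the complete homogeneous symmetric polynomial of degree `n`
in `y` and `z`. -/
theorem sub_mul_aeval_Mform {K : Type*} [Field K] [Algebra ℚ K] {y z : K} (h : y + z = y * z)
    (n : ℕ) : (y - z) * aeval (y * z) (Mform n) = y ^ (n + 1) - z ^ (n + 1) := by
  induction n using Nat.twoStepInduction with
  | zero => simp [Mform]
  | one =>
    simp only [Mform]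
    simp
    linear_combination (z - y) * h
  | more n ih₀ ih₁ =>
    rw [Mform_add_two]
    simp only [map_sub, map_mul, aeval_X]
    linear_combination (y * z) * ih₁ - (y * z) * ih₀ - (y ^ (n + 2) - z ^ (n + 2)) * h

theorem coeff_Tform (n k : ℕ) : (Tform n).coeff k =
    if k ≤ n then (k : ℚ) / ((2 * n - k : ℕ) : ℚ) * (Nat.choose (2 * n - k) (n - k) : ℚ)
    else 0 := by
  rcases Nat.eq_zero_or_pos k with rfl | hk
  · simp only [Tform, finsetSum_coeff, coeff_C_mul, coeff_X_pow]
    rw [Finset.sum_eq_zero]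
    · simp
    · intro j hj
      have : 0 ≠ j := by simp only [Finset.mem_Icc] at hj; omega
      simp [this]
  · simp only [Tform, finsetSum_coeff, coeff_C_mul, coeff_X_pow, mul_ite, mul_one, mul_zero,
      Finset.sum_ite_eq, Finset.mem_Icc]
    simp [Nat.one_le_iff_ne_zero, hk.ne']

/-- The recurrence of the ballot numbers. -/
theorem coeff_Tform_succ {n : ℕ} (hn : 1 ≤ n) (k : ℕ) :
    (Tform (n + 1)).coeff (k + 1) = (Tform (n + 1)).coeff (k + 2) + (Tform n).coeff k := by
  simp only [coeff_Tform]
  rcases lt_trichotomy k n with h | rfl | h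
  · obtain ⟨d, rfl⟩ := Nat.exists_eq_add_of_lt h
    rw [if_pos (by omega), if_pos (by omega), if_pos (by omega),
      show 2 * (k + d + 1 + 1) - (k + 1) = (2 * d + k + 2) + 1 by omega,
      show k + d + 1 + 1 - (k + 1) = d + 1 by omega,
      show 2 * (k + d + 1 + 1) - (k + 2) = 2 * d + k + 2 by omega,
      show k + d + 1 + 1 - (k + 2) = d by omega,
      show 2 * (k + d + 1) - k = 2 * d + k + 2 by omega,
      show k + d + 1 - k = d + 1 by omega, Nat.choose_succ_succ']
    have e := Nat.choose_succ_right_eq (2 * d + k + 2) d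
    rw [show 2 * d + k + 2 - d = d + k + 2 by omega] at e
    have e' : ((2 * d + k + 2).choose (d + 1) : ℚ) * (d + 1) =
        (2 * d + k + 2).choose d * (d + k + 2) := by exact_mod_cast e
    have h₁ : (2 * d + k + 2 : ℚ) ≠ 0 := by positivity
    have h₂ : (2 * d + k + 2 + 1 : ℚ) ≠ 0 := by positivity
    push_cast
    field_simp
    linear_combination 2 * e'
  · have hk : (k : ℚ) ≠ 0 := by positivity
    have hk' : (k + 1 : ℚ) ≠ 0 := by positivity
    simp [show 2 * (k + 1) - (k + 1) = k + 1 by omega, show 2 * k - k = k by omega, hk, hk']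
  · simp [show ¬ k ≤ n by omega, show ¬ k + 1 ≤ n by omega]

theorem Tform_succ_mul_X_sub_one {n : ℕ} (hn : 1 ≤ n) :
    Tform (n + 1) * (X - 1) = X * (X * Tform n) - C ((Tform (n + 1)).coeff 1) * X := by
  ext k
  have h₀ : (Tform (n + 1)).coeff 0 = 0 := by simp [coeff_Tform]
  rcases k with _ | _ | k
  · simp [mul_sub, mul_coeff_zero, h₀]
  · simp [mul_sub, coeff_mul_X, coeff_X_mul, h₀]
  · simp [mul_sub, coeff_mul_X, coeff_X_mul, coeff_Tform_succ hn k]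

theorem mul_aeval_Tform_sub {K : Type*} [Field K] [Algebra ℚ K] {y z : K} (h : y + z = y * z)
    (hy : y - 1 ≠ 0) (hz : z - 1 ≠ 0) {n : ℕ} (hn : 1 ≤ n) :
    y * aeval y (Tform n) - z * aeval z (Tform n) = (y - z) * (y * z) ^ n := by
  induction n, hn using Nat.le_induction with
  | base =>
    simp [Tform]
    linear_combination (y - z) * h
  | succ n hn ih =>
    have step : ∀ {u v : K}, u + v = u * v → u - 1 ≠ 0 → aeval u (Tform (n + 1)) =
        u * v * aeval u (Tform n) - algebraMap ℚ K ((Tform (n + 1)).coeff 1) * v := by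
      intro u v huv hu
      have e := congrArg (aeval u) (Tform_succ_mul_X_sub_one hn)
      simp only [map_mul, map_sub, aeval_X, aeval_C, map_one] at e
      refine mul_right_cancel₀ hu ?_
      linear_combination e - (algebraMap ℚ K ((Tform (n + 1)).coeff 1) -
        u * aeval u (Tform n)) * huv
    rw [step h hy, step (by rw [add_comm, h, mul_comm]) hz]
    linear_combination (y * z) * ih

theorem yR_ne_zero : yR ≠ 0 := RatFunc.X_ne_zero

theorem yR_sub_one_ne_zero : yR - 1 ≠ 0 := by
  have h : (algebraMap ℚ[X] (RatFunc ℚ)) (X - C 1) ≠ 0 :=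
    RatFunc.algebraMap_ne_zero (X_sub_C_ne_zero 1)
  simpa [yR] using h

theorem yR_mul_hatY (t : ℚ[X]) : yR * hatY t =
    yR * aeval yR t - yR / (yR - 1) * aeval (yR / (yR - 1)) t := by
  rw [hatY]
  ring

theorem yR_add_div : yR + yR / (yR - 1) = yR * (yR / (yR - 1)) := by
  have := yR_sub_one_ne_zero
  field_simp
  ring

theorem yR_div_sub_one_ne_zero : yR / (yR - 1) - 1 ≠ 0 := by
  have h := yR_sub_one_ne_zero
  rw [div_sub_one h, sub_sub_cancel]
  exact one_div_ne_zero h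

theorem hatY_eq_hatY_one_mul_aeval {M : ℚ[X] →ₗ[ℚ] ℚ[X]} (hM : ∀ n : ℕ, M (X ^ n) = Mform n)
    (t : ℚ[X]) : hatY t = hatY 1 * aeval (yR * (yR / (yR - 1))) (M t) := by
  refine mul_left_cancel₀ yR_ne_zero ?_
  rw [← mul_assoc, yR_mul_hatY, yR_mul_hatY]
  simp only [map_one, mul_one]
  induction t using Polynomial.induction_on' with
  | add p q hp hq =>
    simp only [map_add]
    linear_combination hp + hq
  | monomial n a =>
    have h : M (monomial n a) = C a * Mform n := by
      rw [← smul_X_eq_monomial, map_smul, hM, smul_eq_C_mul]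
    rw [h, ← C_mul_X_pow_eq_monomial]
    simp only [map_mul (aeval _), aeval_C, map_pow, aeval_X]
    linear_combination -(algebraMap ℚ (RatFunc ℚ) a) * sub_mul_aeval_Mform yR_add_div n

theorem hatY_apply_eq_hatY_one_mul_aeval {T : ℚ[X] →ₗ[ℚ] ℚ[X]} (hT1 : T 1 = 1)
    (hTn : ∀ n : ℕ, 1 ≤ n → T (X ^ n) = Tform n) (p : ℚ[X]) :
    hatY (T p) = hatY 1 * aeval (yR * (yR / (yR - 1))) p := by
  refine mul_left_cancel₀ yR_ne_zero ?_
  rw [← mul_assoc, yR_mul_hatY, yR_mul_hatY]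
  simp only [map_one, mul_one]
  induction p using Polynomial.induction_on' with
  | add p q hp hq =>
    simp only [map_add]
    linear_combination hp + hq
  | monomial n a =>
    have h : T (monomial n a) = C a * T (X ^ n) := by
      rw [← smul_X_eq_monomial, map_smul, smul_eq_C_mul]
    rw [h, ← C_mul_X_pow_eq_monomial]
    rcases Nat.eq_zero_or_pos n with rfl | hn
    · simp only [pow_zero, hT1, mul_one, aeval_C]
      ring
    · simp only [hTn n hn, map_mul (aeval _), aeval_C, map_pow, aeval_X]
      linear_combination (algebraMap ℚ (RatFunc ℚ) a) *
        mul_aeval_Tform_sub yR_add_div yR_sub_one_ne_zero yR_div_sub_one_ne_zero hn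

/-- For all polynomials `t₁, t₂`, with `t₁ ∨ t₂ = 𝒯(ℳ(t₁)·ℳ(t₂))`, one has
`t̂₁ · t̂₂ = (t₁ ∨ t₂)^∧ · 1̂` in `ℚ(y)`. -/
theorem hatY_mul (M T : Polynomial ℚ →ₗ[ℚ] Polynomial ℚ)
    (hM : ∀ n : ℕ, M (Polynomial.X ^ n) = Mform n)
    (hT1 : T 1 = 1)
    (hTn : ∀ n : ℕ, 1 ≤ n → T (Polynomial.X ^ n) = Tform n)
    (t₁ t₂ : Polynomial ℚ) :
    hatY t₁ * hatY t₂ = hatY (T (M t₁ * M t₂)) * hatY 1 := by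
  rw [hatY_apply_eq_hatY_one_mul_aeval hT1 hTn, hatY_eq_hatY_one_mul_aeval hM t₁,
    hatY_eq_hatY_one_mul_aeval hM t₂, map_mul]
  ring
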